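/- In the first-price auction, for every equilibrium strategy profile, Σ_i E[val i] ≥ max{A, C + D} + B, where A = Σ_{i ∈ B_v} E[val i], B = Σ over i ∈ B_u and auctions j with rw(j) = i of E[val i j], C = Σ over all bidders i and auctions j with rw(j) ∈ B_v of E[p i j], and D = Σ over all bidders i and auctions j with rw(j) ∈ B_u and rw(j) ≠ i of E[p i j]. -/

import Mathlib

open MeasureTheory Finset
open scoped Classical

namespace FPA

variable {n m : ℕ}

/-- Bidder `i` wins auction `j` under bid profile `b`: highest bid, ties broken
in favor of larger value, then smaller index. -/
def Wins (v b : Fin n → Fin m → ℝ) (j : Fin m) (i : Fin n) : Prop :=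
  ∀ i', i' ≠ i →
    b i' j < b i j ∨ (b i' j = b i j ∧ (v i' j < v i j ∨ (v i' j = v i j ∧ i < i')))

/-- Indicator that bidder `i` wins auction `j`. -/
noncomputable def xind (v b : Fin n → Fin m → ℝ) (j : Fin m) (i : Fin n) : ℝ :=
  if Wins v b j i then 1 else 0

noncomputable def valij (v b : Fin n → Fin m → ℝ) (i : Fin n) (j : Fin m) : ℝ :=
  xind v b j i * v i j

noncomputable def payij (v b : Fin n → Fin m → ℝ) (i : Fin n) (j : Fin m) : ℝ :=
  xind v b j i * b i j

/-- Admissible strategy: probability distribution over nonnegative bid vectors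
with finite expectations. -/
def Admissible (σ : Measure (Fin m → ℝ)) : Prop :=
  IsProbabilityMeasure σ ∧ (∀ᵐ β ∂σ, ∀ j, 0 ≤ β j) ∧ ∀ j, Integrable (fun β => β j) σ

noncomputable def EValij (v : Fin n → Fin m → ℝ) (μ : Fin n → Measure (Fin m → ℝ))
    (i : Fin n) (j : Fin m) : ℝ :=
  ∫ b, valij v b i j ∂(Measure.pi μ)

noncomputable def EPayij (v : Fin n → Fin m → ℝ) (μ : Fin n → Measure (Fin m → ℝ))
    (i : Fin n) (j : Fin m) : ℝ :=
  ∫ b, payij v b i j ∂(Measure.pi μ)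

noncomputable def EVal (v : Fin n → Fin m → ℝ) (μ : Fin n → Measure (Fin m → ℝ))
    (i : Fin n) : ℝ :=
  ∑ j, EValij v μ i j

noncomputable def EPay (v : Fin n → Fin m → ℝ) (μ : Fin n → Measure (Fin m → ℝ))
    (i : Fin n) : ℝ :=
  ∑ j, EPayij v μ i j

noncomputable def EUtil (v : Fin n → Fin m → ℝ) (μ : Fin n → Measure (Fin m → ℝ))
    (i : Fin n) : ℝ :=
  EVal v μ i - EPay v μ i

/-- A utility maximizer best responds: no admissible deviation improves expected utility. -/
def UtilBest (v : Fin n → Fin m → ℝ) (μ : Fin n → Measure (Fin m → ℝ)) (i : Fin n) : Prop :=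
  ∀ σ, Admissible σ → EUtil v (Function.update μ i σ) i ≤ EUtil v μ i

/-- A value maximizer best responds: its ROI constraint holds and no admissible
deviation satisfying the ROI constraint yields more expected value. -/
def ValBest (v : Fin n → Fin m → ℝ) (μ : Fin n → Measure (Fin m → ℝ)) (i : Fin n) : Prop :=
  EPay v μ i ≤ EVal v μ i ∧
    ∀ σ, Admissible σ →
      EPay v (Function.update μ i σ) i ≤ EVal v (Function.update μ i σ) i →
      EVal v (Function.update μ i σ) i ≤ EVal v μ i

/-- Equilibrium: all strategies admissible, every utility maximizer in `Bu` and
every value maximizer in `Bv` best responds. -/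
def Equilibrium (v : Fin n → Fin m → ℝ) (Bu Bv : Finset (Fin n))
    (μ : Fin n → Measure (Fin m → ℝ)) : Prop :=
  (∀ i, Admissible (μ i)) ∧ (∀ i ∈ Bu, UtilBest v μ i) ∧ (∀ i ∈ Bv, ValBest v μ i)

/-- The rightful winner of auction `j`: the bidder with the highest value,
ties broken toward the smaller index. -/
noncomputable def rwinner [NeZero n] (v : Fin n → Fin m → ℝ) (j : Fin m) : Fin n :=
  (Finset.univ.filter fun i => ∀ i', v i' j ≤ v i j).min' (by
    obtain ⟨i, -, hi⟩ := Finset.exists_max_image (Finset.univ : Finset (Fin n))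
      (fun i => v i j) Finset.univ_nonempty
    exact ⟨i, Finset.mem_filter.mpr ⟨Finset.mem_univ _, fun i' => hi i' (Finset.mem_univ _)⟩⟩)

end FPA

open MeasureTheory Finset

namespace FPA

lemma measurable_bid {n m : ℕ} (i : Fin n) (j : Fin m) :
    Measurable fun b : Fin n → Fin m → ℝ => b i j :=
  (measurable_pi_apply j).comp (measurable_pi_apply i)

lemma measurableSet_wins {n m : ℕ} (v : Fin n → Fin m → ℝ) (j : Fin m) (i : Fin n) :
    MeasurableSet {b : Fin n → Fin m → ℝ | Wins v b j i} := by
  simp only [Wins, Set.ofPred_forall]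
  refine MeasurableSet.iInter fun i' => MeasurableSet.iInter fun _ => ?_
  exact (measurableSet_lt (measurable_bid i' j) (measurable_bid i j)).union
    ((measurableSet_eq_fun (measurable_bid i' j) (measurable_bid i j)).inter
      (MeasurableSet.const _))

lemma measurable_xind {n m : ℕ} (v : Fin n → Fin m → ℝ) (j : Fin m) (i : Fin n) :
    Measurable fun b : Fin n → Fin m → ℝ => xind v b j i :=
  Measurable.ite (measurableSet_wins v j i) measurable_const measurable_const

lemma measurable_valij {n m : ℕ} (v : Fin n → Fin m → ℝ) (i : Fin n) (j : Fin m) :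
    Measurable fun b : Fin n → Fin m → ℝ => valij v b i j :=
  (measurable_xind v j i).mul measurable_const

lemma measurable_payij {n m : ℕ} (v : Fin n → Fin m → ℝ) (i : Fin n) (j : Fin m) :
    Measurable fun b : Fin n → Fin m → ℝ => payij v b i j :=
  (measurable_xind v j i).mul (measurable_bid i j)

lemma xind_nonneg {n m : ℕ} (v b : Fin n → Fin m → ℝ) (j : Fin m) (i : Fin n) :
    0 ≤ xind v b j i := by
  unfold xind
  split_ifs <;> norm_num

lemma xind_congr {n m : ℕ} (v : Fin n → Fin m → ℝ) {b b' : Fin n → Fin m → ℝ} {j : Fin m}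
    (h : ∀ i, b i j = b' i j) (i : Fin n) : xind v b j i = xind v b' j i := by
  have : Wins v b j i ↔ Wins v b' j i := by simp only [Wins, h]
  simp only [xind, this]

lemma EValij_nonneg {n m : ℕ} {v : Fin n → Fin m → ℝ} (hv : ∀ i j, 0 ≤ v i j)
    (μ : Fin n → Measure (Fin m → ℝ)) (i : Fin n) (j : Fin m) : 0 ≤ EValij v μ i j :=
  integral_nonneg fun b => mul_nonneg (xind_nonneg v b j i) (hv i j)

/-- Replace the bid of bidder `i` in auction `j` by zero. -/
def dropBid {n m : ℕ} (i : Fin n) (j : Fin m) (b : Fin n → Fin m → ℝ) : Fin n → Fin m → ℝ :=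
  Function.update b i (Function.update (b i) j 0)

lemma measurable_update_zero {m : ℕ} (j : Fin m) :
    Measurable fun β : Fin m → ℝ => Function.update β j 0 :=
  measurable_pi_iff.2 fun k => by
    rcases eq_or_ne k j with rfl | h
    · simp
    · simpa [h] using measurable_pi_apply k

lemma measurable_dropBid {n m : ℕ} (i : Fin n) (j : Fin m) :
    Measurable (dropBid (n := n) i j) :=
  measurable_pi_iff.2 fun k => by
    rcases eq_or_ne k i with rfl | h
    · simpa [dropBid, Function.comp_def] using (measurable_update_zero j).comp (measurable_pi_apply k)
    · simpa [dropBid, h] using measurable_pi_apply k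

lemma dropBid_apply_of_ne {n m : ℕ} (i i' : Fin n) {j k : Fin m} (hk : k ≠ j)
    (b : Fin n → Fin m → ℝ) : dropBid i j b i' k = b i' k := by
  rcases eq_or_ne i' i with rfl | h
  · simp [dropBid, hk]
  · simp [dropBid, h]

lemma dropBid_self {n m : ℕ} (i : Fin n) (j : Fin m) (b : Fin n → Fin m → ℝ) :
    dropBid i j b i j = 0 := by
  simp [dropBid]

lemma pi_update_map {n m : ℕ} (μ : Fin n → Measure (Fin m → ℝ))
    [∀ i, IsProbabilityMeasure (μ i)] (i : Fin n) (j : Fin m) :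
    Measure.pi (Function.update μ i ((μ i).map fun β => Function.update β j 0)) =
      (Measure.pi μ).map (dropBid i j) := by
  let f : Fin n → (Fin m → ℝ) → (Fin m → ℝ) :=
    Function.update (fun _ β => β) i fun β => Function.update β j 0
  have hf : ∀ k, Measurable (f k) := fun k => by
    rcases eq_or_ne k i with rfl | h
    · simpa [f] using measurable_update_zero j
    · simpa [f, h] using measurable_id'
  have (k : Fin n) : IsProbabilityMeasure ((μ k).map (f k)) :=
    Measure.isProbabilityMeasure_map (hf k).aemeasurable
  have hmap := Measure.pi_map_pi (μ := μ) fun k => (hf k).aemeasurable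
  have hμ : (fun k => (μ k).map (f k)) =
      Function.update μ i ((μ i).map fun β => Function.update β j 0) := by
    funext k
    rcases eq_or_ne k i with rfl | h
    · simp [f]
    · simp [f, h]
  have hdrop : (fun b k => f k (b k)) = dropBid i j := by
    funext b k
    rcases eq_or_ne k i with rfl | h
    · simp [f, dropBid]
    · simp [f, dropBid, h]
  rw [hμ, hdrop] at hmap
  exact hmap.symm

lemma Admissible.map_update_zero {m : ℕ} {σ : Measure (Fin m → ℝ)} (hσ : Admissible σ)
    (j : Fin m) : Admissible (σ.map fun β => Function.update β j 0) := by
  obtain ⟨hprob, hnonneg, hint⟩ := hσ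
  have hmeas := measurable_update_zero j
  refine ⟨Measure.isProbabilityMeasure_map hmeas.aemeasurable, ?_, fun k => ?_⟩
  · rw [ae_map_iff hmeas.aemeasurable]
    · filter_upwards [hnonneg] with β hβ k
      rcases eq_or_ne k j with rfl | h
      · simp
      · simpa [h] using hβ k
    · simp only [Set.ofPred_forall]
      exact MeasurableSet.iInter fun k => measurableSet_le measurable_const (measurable_pi_apply k)
  · rw [integrable_map_measure (measurable_pi_apply k).aestronglyMeasurable hmeas.aemeasurable]
    rcases eq_or_ne k j with rfl | h
    · simp [Function.comp_def]
    · simpa [Function.comp_def, h] using hint k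

/-- A best-responding utility maximizer does not lose in expectation in any single auction,
since she could bid zero there. -/
lemma UtilBest.EPayij_le_EValij {n m : ℕ} {v : Fin n → Fin m → ℝ} (hv : ∀ i j, 0 ≤ v i j)
    {μ : Fin n → Measure (Fin m → ℝ)} (hμ : ∀ i, Admissible (μ i)) {i : Fin n}
    (hi : UtilBest v μ i) (j : Fin m) : EPayij v μ i j ≤ EValij v μ i j := by
  have := fun k => (hμ k).1
  have hdev := hi _ ((hμ i).map_update_zero j)
  set ν := Function.update μ i ((μ i).map fun β => Function.update β j 0)
  have hν : Measure.pi ν = (Measure.pi μ).map (dropBid i j) := pi_update_map μ i j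
  have hval : ∀ k ≠ j, EValij v ν i k = EValij v μ i k := fun k hk => by
    rw [EValij, hν, integral_map (measurable_dropBid i j).aemeasurable
      (measurable_valij v i k).aestronglyMeasurable]
    simp only [EValij, valij, xind_congr v (fun i' => dropBid_apply_of_ne i i' hk _)]
  have hpay : ∀ k ≠ j, EPayij v ν i k = EPayij v μ i k := fun k hk => by
    rw [EPayij, hν, integral_map (measurable_dropBid i j).aemeasurable
      (measurable_payij v i k).aestronglyMeasurable]
    simp only [EPayij, payij, xind_congr v (fun i' => dropBid_apply_of_ne i i' hk _),
      dropBid_apply_of_ne i i hk]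
  have hzero : EPayij v ν i j = 0 := by
    rw [EPayij, hν, integral_map (measurable_dropBid i j).aemeasurable
      (measurable_payij v i j).aestronglyMeasurable]
    simp [payij, dropBid_self]
  have hnonneg : 0 ≤ EValij v ν i j := EValij_nonneg hv ν i j
  simp only [EUtil, EVal, EPay, ← Finset.add_sum_erase _ _ (Finset.mem_univ j)] at hdev
  rw [Finset.sum_congr rfl fun k hk => hval k (Finset.ne_of_mem_erase hk),
    Finset.sum_congr rfl fun k hk => hpay k (Finset.ne_of_mem_erase hk)] at hdev
  linarith

end FPA

/-- Lemma 4 of the paper. In any equilibrium of the first-price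
auction, the welfare is at least `max {A, C + D} + B`. -/
theorem fpa_combination_lemma {n m : ℕ} [NeZero n]
    (v : Fin n → Fin m → ℝ) (hv : ∀ i j, 0 ≤ v i j)
    (Bu Bv : Finset (Fin n)) (hdisj : Disjoint Bu Bv) (hcover : Bu ∪ Bv = Finset.univ)
    (μ : Fin n → Measure (Fin m → ℝ))
    (heq : FPA.Equilibrium v Bu Bv μ) :
    ∑ i, FPA.EVal v μ i ≥
      max (∑ i ∈ Bv, FPA.EVal v μ i)
        ((∑ i : Fin n, ∑ j ∈ Finset.univ.filter (fun j => FPA.rwinner v j ∈ Bv),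
            FPA.EPayij v μ i j) +
          ∑ i : Fin n, ∑ j ∈ Finset.univ.filter
              (fun j => FPA.rwinner v j ∈ Bu ∧ FPA.rwinner v j ≠ i),
            FPA.EPayij v μ i j) +
      ∑ i ∈ Bu, ∑ j ∈ Finset.univ.filter (fun j => FPA.rwinner v j = i),
        FPA.EValij v μ i j := by
  obtain ⟨hadm, hBu, hBv⟩ := heq
  have hsplit (f : Fin n → ℝ) : ∑ i, f i = ∑ i ∈ Bv, f i + ∑ i ∈ Bu, f i := by
    rw [← hcover, Finset.sum_union hdisj, add_comm]
  have hmem (i : Fin n) : i ∈ Bu ∨ i ∈ Bv :=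
    Finset.mem_union.1 (hcover ▸ Finset.mem_univ i)
  have hval := FPA.EValij_nonneg hv μ
  have hvalue_part : ∑ i ∈ Bu, ∑ j ∈ Finset.univ.filter (fun j => FPA.rwinner v j = i),
      FPA.EValij v μ i j ≤ ∑ i ∈ Bu, FPA.EVal v μ i :=
    Finset.sum_le_sum fun i _ =>
      Finset.sum_le_sum_of_subset_of_nonneg (Finset.filter_subset _ _) fun j _ _ => hval i j
  rw [ge_iff_le, max_add, max_le_iff]
  constructor
  · rw [hsplit]
    linarith
  rw [← Finset.sum_add_distrib, hsplit, hsplit (FPA.EVal v μ), add_assoc,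
    ← Finset.sum_add_distrib]
  simp only [Finset.sum_filter, ← Finset.sum_add_distrib]
  refine add_le_add (Finset.sum_le_sum fun i hi => ?_) (Finset.sum_le_sum fun i hi => ?_)
  · refine le_trans (le_of_eq (Finset.sum_congr rfl fun j _ => ?_)) (hBv i hi).1
    by_cases hj : FPA.rwinner v j ∈ Bv
    · simp [hj, Finset.disjoint_right.1 hdisj hj]
    · have hj' := (hmem (FPA.rwinner v j)).resolve_right hj
      have hne : FPA.rwinner v j ≠ i := fun h => hj (h ▸ hi)
      simp [hj, hj', hne]
  · refine Finset.sum_le_sum fun j _ => ?_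
    have hle := (hBu i hi).EPayij_le_EValij hv hadm j
    by_cases hji : FPA.rwinner v j = i
    · simp [hji, Finset.disjoint_left.1 hdisj hi]
    · by_cases hj : FPA.rwinner v j ∈ Bv
      · simpa [hj, hji, Finset.disjoint_right.1 hdisj hj] using hle
      · simpa [hj, hji, (hmem (FPA.rwinner v j)).resolve_right hj] using hle
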